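/- Let (K, w, A) be a weighted graph. Then π₁(K, w, A) is isomorphic to the free product (Monoid.Coprod) of the free group on the set of edges of K not lying in A with the free product (Monoid.CoprodI) of the family (ℤ/w(ab)) indexed by the edges ab of A. (The free group on the set of edges not in A is the ordinary fundamental group π₁(K) of the graph K.) -/

import Mathlib

open scoped Classical

variable {V : Type*}

/-- Generators of the weighted fundamental group: edges `ab` of `K` with `a < b`. -/
def WGen [LinearOrder V] (K : SimpleGraph V) : Type _ :=
  {p : V × V // p.1 < p.2 ∧ K.Adj p.1 p.2}

/-- The relators of the weighted fundamental group: (1) `g_{ab}^{w(ab)}` for edges of the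
spanning tree `A`; (2) `g_{ab}^{w(ab)} · (g_{av}^{w(av)} · g_{vb}^{w(vb)})⁻¹` for 2-simplices
`{a, v, b} ∈ T` with `a < v < b`. -/
def WRelators [LinearOrder V] (K : SimpleGraph V) (T : Set (Finset V))
    (w : Sym2 V → ℤ) (A : SimpleGraph V) : Set (FreeGroup (WGen K)) :=
  {r | ∃ e : WGen K, A.Adj e.1.1 e.1.2 ∧ r = FreeGroup.of e ^ w s(e.1.1, e.1.2)} ∪
  {r | ∃ (a v b : V) (hav : a < v) (hvb : v < b)
       (h1 : K.Adj a v) (h2 : K.Adj v b) (h3 : K.Adj a b),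
       ({a, v, b} : Finset V) ∈ T ∧
       r = FreeGroup.of (⟨(a, b), hav.trans hvb, h3⟩ : WGen K) ^ w s(a, b) *
         (FreeGroup.of (⟨(a, v), hav, h1⟩ : WGen K) ^ w s(a, v) *
          FreeGroup.of (⟨(v, b), hvb, h2⟩ : WGen K) ^ w s(v, b))⁻¹}

/-- The weighted fundamental group `π₁(K, w, A)` of the WSC `(K, T, w, A)`,
as a presented group. -/
def wpi1 [LinearOrder V] (K : SimpleGraph V) (T : Set (Finset V))
    (w : Sym2 V → ℤ) (A : SimpleGraph V) : Type _ :=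
  PresentedGroup (WRelators K T w A)

noncomputable instance [LinearOrder V] (K : SimpleGraph V) (T : Set (Finset V))
    (w : Sym2 V → ℤ) (A : SimpleGraph V) : Group (wpi1 K T w A) := by
  unfold wpi1; infer_instance

/-- `(K, T, w, A)` is a weighted simplicial complex: `K` is a connected simple graph,
`T` is a set of 2-simplices (unordered triples of distinct pairwise adjacent vertices),
and `A` is a spanning tree of `K`. -/
structure IsWSC (K : SimpleGraph V) (T : Set (Finset V))
    (w : Sym2 V → ℤ) (A : SimpleGraph V) : Prop where
  conn : K.Connected
  tri : ∀ t ∈ T, ∃ a v b : V, a ≠ v ∧ v ≠ b ∧ a ≠ b ∧ t = {a, v, b} ∧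
        K.Adj a v ∧ K.Adj v b ∧ K.Adj a b
  tree : A.IsTree
  le : A ≤ K

/-- Exactly two of the three edges of every 2-simplex of `T` lie in the tree `A`. -/
def ExactlyTwo [LinearOrder V] (T : Set (Finset V)) (A : SimpleGraph V) : Prop :=
  ∀ a v b : V, a < v → v < b → ({a, v, b} : Finset V) ∈ T →
    ((if A.Adj a b then 1 else 0) + (if A.Adj a v then 1 else 0) +
      (if A.Adj v b then 1 else 0) : ℕ) = 2

/-- The cyclic group homomorphism sending the generator to `g`, when `g ^ n = 1`. -/
noncomputable def zmodHom {G : Type*} [Group G] (n : ℕ) (g : G) (h : g ^ n = 1) :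
    Multiplicative (ZMod n) →* G :=
  AddMonoidHom.toMultiplicativeLeft
    (ZMod.lift n ⟨zmultiplesHom (Additive G) (Additive.ofMul g), by
      rw [zmultiplesHom_apply, natCast_zsmul, ← ofMul_pow, h, ofMul_one]⟩)

theorem zmodHom_one {G : Type*} [Group G] (n : ℕ) (g : G) (h : g ^ n = 1) :
    zmodHom n g h (Multiplicative.ofAdd 1) = g := by
  have := ZMod.lift_coe n ⟨zmultiplesHom (Additive G) (Additive.ofMul g), by
      rw [zmultiplesHom_apply, natCast_zsmul, ← ofMul_pow, h, ofMul_one]⟩ 1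
  rw [Int.cast_one] at this
  change Additive.toMul (ZMod.lift n _ 1) = g
  rw [this]
  simp

theorem zmod_hom_ext {G : Type*} [Group G] (n : ℕ) (f g : Multiplicative (ZMod n) →* G)
    (h : f (Multiplicative.ofAdd 1) = g (Multiplicative.ofAdd 1)) : f = g := by
  refine MonoidHom.ext fun x => ?_
  obtain ⟨k, hk⟩ := ZMod.intCast_surjective x.toAdd
  have hx : x = (Multiplicative.ofAdd (1 : ZMod n)) ^ k := by
    rw [← ofAdd_zsmul, zsmul_one, hk, ofAdd_toAdd]
  rw [hx, map_zpow, map_zpow, h]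

theorem zpow_natAbs_iff {G : Type*} [Group G] (g : G) (k : ℤ) :
    g ^ k.natAbs = 1 ↔ g ^ k = 1 := by
  rw [← orderOf_dvd_iff_pow_eq_one, ← orderOf_dvd_iff_zpow_eq_one, Int.natCast_dvd]

/-- General form: a presented group in which each generator satisfying `P` is given
exponent `k`, and the others are free. -/
theorem presented_decomp {α : Type*} (P : α → Prop) (k : α → ℤ) (R : Set (FreeGroup α))
    (hR : ∀ r, r ∈ R ↔ ∃ e, P e ∧ r = FreeGroup.of e ^ k e) :
    Nonempty (PresentedGroup R ≃* Monoid.Coprod (FreeGroup {e : α // ¬ P e})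
      (Monoid.CoprodI (fun e : {e : α // P e} => Multiplicative (ZMod (k e.1).natAbs)))) := by
  let f : α → Monoid.Coprod (FreeGroup {e : α // ¬ P e})
      (Monoid.CoprodI (fun e : {e : α // P e} => Multiplicative (ZMod (k e.1).natAbs))) :=
    fun e => if h : P e then
        Monoid.Coprod.inr (Monoid.CoprodI.of (i := (⟨e, h⟩ : {e : α // P e}))
          (Multiplicative.ofAdd (1 : ZMod (k e).natAbs)))
      else Monoid.Coprod.inl (FreeGroup.of ⟨e, h⟩)
  have hf : ∀ r ∈ R, FreeGroup.lift f r = 1 := by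
    intro r hr
    obtain ⟨e, he, rfl⟩ := (hR r).1 hr
    rw [map_zpow, FreeGroup.lift_apply_of, ← zpow_natAbs_iff]
    simp only [f, dif_pos he]
    rw [← map_pow, ← map_pow, ← ofAdd_nsmul, nsmul_one, ZMod.natCast_self, ofAdd_zero,
      map_one, map_one]
  have hp : ∀ e : {e : α // P e},
      (PresentedGroup.of e.1 : PresentedGroup R) ^ (k e.1).natAbs = 1 := by
    intro e
    rw [zpow_natAbs_iff]
    have := PresentedGroup.one_of_mem ((hR _).2 ⟨e.1, e.2, rfl⟩)
    rwa [map_zpow] at this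
  let φ := PresentedGroup.toGroup hf
  let ψ := Monoid.Coprod.lift
    (FreeGroup.lift (fun e : {e : α // ¬ P e} => (PresentedGroup.of e.1 : PresentedGroup R)))
    (Monoid.CoprodI.lift (fun e : {e : α // P e} => zmodHom _ _ (hp e)))
  refine ⟨MonoidHom.toMulEquiv φ ψ ?_ ?_⟩
  · refine PresentedGroup.ext fun x => ?_
    simp only [MonoidHom.comp_apply, MonoidHom.id_apply, φ, PresentedGroup.toGroup.of]
    by_cases h : P x
    · simp only [f, dif_pos h, ψ, Monoid.Coprod.lift_apply_inr, Monoid.CoprodI.lift_of]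
      exact zmodHom_one _ _ _
    · simp only [f, dif_neg h, ψ, Monoid.Coprod.lift_apply_inl, FreeGroup.lift_apply_of]
  · refine Monoid.Coprod.hom_ext ?_ ?_
    · refine FreeGroup.ext_hom _ _ fun e => ?_
      simp only [MonoidHom.comp_apply, MonoidHom.id_apply, ψ, Monoid.Coprod.lift_apply_inl,
        FreeGroup.lift_apply_of, φ, PresentedGroup.toGroup.of, f, dif_neg e.2]
    · refine Monoid.CoprodI.ext_hom _ _ fun e => ?_
      refine zmod_hom_ext (G := Monoid.Coprod (FreeGroup {e : α // ¬ P e})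
        (Monoid.CoprodI (fun e : {e : α // P e} => Multiplicative (ZMod (k e.1).natAbs))))
        (k e.1).natAbs _ _ ?_
      simp only [MonoidHom.comp_apply, MonoidHom.id_apply, ψ, Monoid.Coprod.lift_apply_inr,
        Monoid.CoprodI.lift_of, zmodHom_one, φ, PresentedGroup.toGroup.of, f, dif_pos e.2]

/-- Corollary 3.4. For a weighted graph `(K, w, A)`, the weighted fundamental
group is the free product of the free group on the edges of `K` not lying in `A` (which is the
ordinary fundamental group `π₁(K)` of the graph `K`) with the free product of the cyclic groups
`ℤ/w(ab)` over the edges `ab` of `A`. -/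
theorem weighted_pi1_graph_decomp [LinearOrder V] (K : SimpleGraph V) (w : Sym2 V → ℤ)
    (A : SimpleGraph V) (hwsc : IsWSC K (∅ : Set (Finset V)) w A) :
    Nonempty (wpi1 K (∅ : Set (Finset V)) w A ≃*
      Monoid.Coprod (FreeGroup {e : WGen K // ¬ A.Adj e.1.1 e.1.2})
        (Monoid.CoprodI (fun e : {e : WGen K // A.Adj e.1.1 e.1.2} =>
          Multiplicative (ZMod (w s(e.1.1.1, e.1.1.2)).natAbs)))) := by
  exact presented_decomp (fun e : WGen K => A.Adj e.1.1 e.1.2)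
    (fun e => w s(e.1.1, e.1.2)) (WRelators K ∅ w A) (by
      intro r
      simp [WRelators])
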